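/- Let (a_l)_{l∈ℤ^d} be real with a_l = a_{−l}, Σ|a_l| < ∞, K(x) = Σ_{l∈ℤ^d} a_l e^{i l·x}, and suppose ρ_j(0) ≠ 0 for all j ∈ Ω_n* = Ω_n∖{0}. Then the fundamental sk-spline s̃k_n(x) = 1/N + (1/N)Σ_{j∈Ω_n*} ρ_j(x)/ρ_j(0) satisfies s̃k_n(x_k) = 1 if k = 0 and s̃k_n(x_k) = 0 for every k ∈ Ω_n*. -/

import Mathlib

open Real Finset MeasureTheory

noncomputable section

/-- The index set `Ω_n = {j ∈ ℤ^d : 0 ≤ j_l ≤ 2 n_l - 1}`. -/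
def Omega (d : ℕ) (n : Fin d → ℕ) : Finset (Fin d → ℤ) :=
  Fintype.piFinset fun i => Finset.Icc (0 : ℤ) (2 * (n i : ℤ) - 1)

/-- The knot `x_k = (π k₁ / n₁, …, π k_d / n_d)`. -/
def knot (d : ℕ) (n : Fin d → ℕ) (k : Fin d → ℤ) : Fin d → ℝ :=
  fun i => π * (k i : ℝ) / (n i : ℝ)

/-- The dot product `l · x` for `l ∈ ℤ^d`, `x ∈ ℝ^d`. -/
def dotI (d : ℕ) (l : Fin d → ℤ) (x : Fin d → ℝ) : ℝ := ∑ i, (l i : ℝ) * x i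

/-- `N = 2^d n₁ ⋯ n_d`. -/
def Nn (d : ℕ) (n : Fin d → ℕ) : ℝ := ∏ i : Fin d, (2 * (n i : ℝ))

/-- `Ω_n^* = Ω_n \ {0}`. -/
def OmegaStar (d : ℕ) (n : Fin d → ℕ) : Finset (Fin d → ℤ) :=
  (Omega d n).erase 0

/-- `λ_j(x) = Σ_{k ∈ Ω_n} e^{i j·x_k} K(x - x_k)`. -/
def lam (d : ℕ) (n : Fin d → ℕ) (K : (Fin d → ℝ) → ℝ) (j : Fin d → ℤ)
    (x : Fin d → ℝ) : ℂ :=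
  ∑ k ∈ Omega d n, Complex.exp (Complex.I * (dotI d j (knot d n k) : ℂ)) *
    (K (x - knot d n k) : ℂ)

/-- `ρ_j(x) = (2/N)·Re λ_j(x)`. -/
def rho (d : ℕ) (n : Fin d → ℕ) (K : (Fin d → ℝ) → ℝ) (j : Fin d → ℤ)
    (x : Fin d → ℝ) : ℝ := (2 / Nn d n) * (lam d n K j x).re

/-- `σ_j(x) = (2/N)·Im λ_j(x)`. -/
def sigma' (d : ℕ) (n : Fin d → ℕ) (K : (Fin d → ℝ) → ℝ) (j : Fin d → ℤ)
    (x : Fin d → ℝ) : ℝ := (2 / Nn d n) * (lam d n K j x).im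

/-- The fundamental sk-spline `s̃k_n(x) = 1/N + (1/N) Σ_{j∈Ω_n*} ρ_j(x)/ρ_j(0)`. -/
def fundSk (d : ℕ) (n : Fin d → ℕ) (K : (Fin d → ℝ) → ℝ) (x : Fin d → ℝ) : ℝ :=
  1 / Nn d n + (1 / Nn d n) * ∑ j ∈ OmegaStar d n, rho d n K j x / rho d n K j 0

/-- The interpolating sk-spline `sk_n(f,x) = Σ_{k∈Ω_n} f(x_k) s̃k_n(x - x_k)`. -/
def skInterp (d : ℕ) (n : Fin d → ℕ) (K : (Fin d → ℝ) → ℝ)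
    (f : (Fin d → ℝ) → ℝ) (x : Fin d → ℝ) : ℝ :=
  ∑ k ∈ Omega d n, f (knot d n k) * fundSk d n K (x - knot d n k)

/-- The (complex-valued) kernel `K(x) = Σ_{l ∈ ℤ^d} a_l e^{i l·x}`. -/
def Kc (d : ℕ) (a : (Fin d → ℤ) → ℝ) (x : Fin d → ℝ) : ℂ :=
  ∑' l : Fin d → ℤ, (a l : ℂ) * Complex.exp (Complex.I * (dotI d l x : ℂ))

/-- The real part of the kernel; for `a_l = a_{-l}` this is the kernel itself. -/
def Kr (d : ℕ) (a : (Fin d → ℤ) → ℝ) (x : Fin d → ℝ) : ℝ := (Kc d a x).re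

/-- Reduction of the multi-index `k` modulo `2 n`, coordinatewise. -/
def reduceIndex (d : ℕ) (n : Fin d → ℕ) (k : Fin d → ℤ) : Fin d → ℤ :=
  fun i => k i % (2 * (n i : ℤ))

theorem mem_Omega {d : ℕ} {n : Fin d → ℕ} {k : Fin d → ℤ} :
    k ∈ Omega d n ↔ ∀ i, 0 ≤ k i ∧ k i < 2 * (n i : ℤ) := by
  simp only [Omega, Fintype.mem_piFinset, Finset.mem_Icc]
  exact forall_congr' fun i => by omega

theorem reduceIndex_mem {d : ℕ} {n : Fin d → ℕ} (hn : ∀ i, 1 ≤ n i) (k : Fin d → ℤ) :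
    reduceIndex d n k ∈ Omega d n := by
  refine mem_Omega.2 fun i => ?_
  have h := hn i
  exact ⟨Int.emod_nonneg _ (by omega), Int.emod_lt_of_pos _ (by omega)⟩

theorem reduceIndex_of_mem {d : ℕ} {n : Fin d → ℕ} {k : Fin d → ℤ} (hk : k ∈ Omega d n) :
    reduceIndex d n k = k :=
  funext fun i => Int.emod_eq_of_lt (mem_Omega.1 hk i).1 (mem_Omega.1 hk i).2

theorem sum_Omega_add {d : ℕ} {n : Fin d → ℕ} (hn : ∀ i, 1 ≤ n i) (m : Fin d → ℤ)
    (f : (Fin d → ℤ) → ℂ) (hf : ∀ k, f (reduceIndex d n k) = f k) :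
    ∑ k ∈ Omega d n, f (k + m) = ∑ k ∈ Omega d n, f k := by
  refine Finset.sum_nbij' (fun k => reduceIndex d n (k + m)) (fun k => reduceIndex d n (k - m))
    (fun k _ => reduceIndex_mem hn _) (fun k _ => reduceIndex_mem hn _) (fun k hk => ?_)
    (fun k hk => ?_) (fun k _ => (hf _).symm)
  · conv_rhs => rw [← reduceIndex_of_mem hk]
    funext i
    simp [reduceIndex]
  · conv_rhs => rw [← reduceIndex_of_mem hk]
    funext i
    simp [reduceIndex]

theorem sum_Omega_neg {d : ℕ} {n : Fin d → ℕ} (hn : ∀ i, 1 ≤ n i)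
    (f : (Fin d → ℤ) → ℂ) (hf : ∀ k, f (reduceIndex d n k) = f k) :
    ∑ k ∈ Omega d n, f (-k) = ∑ k ∈ Omega d n, f k := by
  have key : ∀ k ∈ Omega d n, reduceIndex d n (-reduceIndex d n (-k)) = k := fun k hk => by
    conv_rhs => rw [← reduceIndex_of_mem hk]
    funext i
    have h : -((-k i) % (2 * (n i : ℤ))) ≡ -(-k i) [ZMOD 2 * (n i : ℤ)] :=
      (Int.mod_modEq _ _).neg
    rw [neg_neg] at h
    exact h
  exact Finset.sum_nbij' (fun k => reduceIndex d n (-k)) (fun k => reduceIndex d n (-k))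
    (fun k _ => reduceIndex_mem hn _) (fun k _ => reduceIndex_mem hn _) key key
    (fun k _ => (hf _).symm)

theorem knot_zero (d : ℕ) (n : Fin d → ℕ) : knot d n 0 = 0 := by
  funext i
  simp [knot]

theorem knot_add (d : ℕ) (n : Fin d → ℕ) (k m : Fin d → ℤ) :
    knot d n (k + m) = knot d n k + knot d n m := by
  funext i
  simp [knot]
  ring

theorem knot_neg (d : ℕ) (n : Fin d → ℕ) (k : Fin d → ℤ) :
    knot d n (-k) = -knot d n k := by
  funext i
  simp [knot]
  ring

theorem knot_reduceIndex {d : ℕ} {n : Fin d → ℕ} (hn : ∀ i, 1 ≤ n i) (k : Fin d → ℤ) :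
    knot d n (reduceIndex d n k) =
      knot d n k - fun i => 2 * π * ((k i / (2 * (n i : ℤ)) : ℤ) : ℝ) := by
  funext i
  have h : (n i : ℝ) ≠ 0 := by
    have := hn i
    positivity
  have e : ((k i % (2 * (n i : ℤ)) : ℤ) : ℝ) =
      k i - 2 * n i * ((k i / (2 * (n i : ℤ)) : ℤ) : ℝ) := by
    rw [Int.emod_def]
    push_cast
    ring
  simp only [knot, reduceIndex, Pi.sub_apply]
  rw [e]
  field_simp

theorem dotI_add_right (d : ℕ) (l : Fin d → ℤ) (x y : Fin d → ℝ) :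
    dotI d l (x + y) = dotI d l x + dotI d l y := by
  simp [dotI, mul_add, Finset.sum_add_distrib]

theorem dotI_sub_right (d : ℕ) (l : Fin d → ℤ) (x y : Fin d → ℝ) :
    dotI d l (x - y) = dotI d l x - dotI d l y := by
  simp [dotI, mul_sub, Finset.sum_sub_distrib]

theorem dotI_neg_right (d : ℕ) (l : Fin d → ℤ) (x : Fin d → ℝ) :
    dotI d l (-x) = -dotI d l x := by
  simp [dotI]

theorem dotI_neg_left (d : ℕ) (l : Fin d → ℤ) (x : Fin d → ℝ) :
    dotI d (-l) x = -dotI d l x := by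
  simp [dotI]

theorem dotI_zero_right (d : ℕ) (l : Fin d → ℤ) : dotI d l 0 = 0 := by
  simp [dotI]

theorem dotI_knot_comm (d : ℕ) (n : Fin d → ℕ) (j k : Fin d → ℤ) :
    dotI d j (knot d n k) = dotI d k (knot d n j) :=
  Finset.sum_congr rfl fun i _ => by
    simp only [knot]
    ring

theorem exp_dotI_sub_two_pi (d : ℕ) (l q : Fin d → ℤ) (x : Fin d → ℝ) :
    Complex.exp (Complex.I * (dotI d l (x - fun i => 2 * π * (q i : ℝ)) : ℂ)) =
      Complex.exp (Complex.I * (dotI d l x : ℂ)) := by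
  refine Complex.exp_eq_exp_iff_exists_int.2 ⟨-∑ i, l i * q i, ?_⟩
  have h : dotI d l (fun i => 2 * π * (q i : ℝ)) = ((∑ i, l i * q i : ℤ) : ℝ) * (2 * π) := by
    simp only [dotI]
    push_cast
    rw [Finset.sum_mul]
    exact Finset.sum_congr rfl fun i _ => by ring
  rw [dotI_sub_right, h]
  push_cast
  ring

theorem exp_dotI_knot_reduceIndex {d : ℕ} {n : Fin d → ℕ} (hn : ∀ i, 1 ≤ n i)
    (j k : Fin d → ℤ) :
    Complex.exp (Complex.I * (dotI d j (knot d n (reduceIndex d n k)) : ℂ)) =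
      Complex.exp (Complex.I * (dotI d j (knot d n k) : ℂ)) := by
  rw [knot_reduceIndex hn]
  exact exp_dotI_sub_two_pi d j (fun i => k i / (2 * (n i : ℤ))) _

theorem Kr_neg (d : ℕ) (a : (Fin d → ℤ) → ℝ) (ha : ∀ l, a (-l) = a l) (x : Fin d → ℝ) :
    Kr d a (-x) = Kr d a x := by
  unfold Kr Kc
  rw [← (Equiv.neg (Fin d → ℤ)).tsum_eq]
  simp [ha, dotI_neg_left, dotI_neg_right]

theorem Kr_sub_two_pi (d : ℕ) (a : (Fin d → ℤ) → ℝ) (x : Fin d → ℝ) (q : Fin d → ℤ) :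
    Kr d a (x - fun i => 2 * π * (q i : ℝ)) = Kr d a x := by
  unfold Kr Kc
  simp only [exp_dotI_sub_two_pi]

theorem Kr_sub_knot_reduceIndex {d : ℕ} {n : Fin d → ℕ} (hn : ∀ i, 1 ≤ n i)
    (a : (Fin d → ℤ) → ℝ) (x : Fin d → ℝ) (k : Fin d → ℤ) :
    Kr d a (x - knot d n (reduceIndex d n k)) = Kr d a (x - knot d n k) := by
  rw [← Kr_sub_two_pi d a (x - knot d n (reduceIndex d n k)) fun i => k i / (2 * (n i : ℤ)),
    knot_reduceIndex hn]
  congr 1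
  abel

theorem lam_knot {d : ℕ} {n : Fin d → ℕ} (hn : ∀ i, 1 ≤ n i) (a : (Fin d → ℤ) → ℝ)
    (j m : Fin d → ℤ) :
    lam d n (Kr d a) j (knot d n m) =
      Complex.exp (Complex.I * (dotI d j (knot d n m) : ℂ)) * lam d n (Kr d a) j 0 := by
  unfold lam
  rw [← sum_Omega_add hn m _ fun k => by
    rw [exp_dotI_knot_reduceIndex hn, Kr_sub_knot_reduceIndex hn], Finset.mul_sum]
  refine Finset.sum_congr rfl fun k _ => ?_
  have h : knot d n m - knot d n (k + m) = 0 - knot d n k := by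
    rw [knot_add]
    abel
  rw [h, knot_add, dotI_add_right, Complex.ofReal_add, mul_add, Complex.exp_add]
  ring

theorem lam_zero_im {d : ℕ} {n : Fin d → ℕ} (hn : ∀ i, 1 ≤ n i) (a : (Fin d → ℤ) → ℝ)
    (ha : ∀ l, a (-l) = a l) (j : Fin d → ℤ) :
    (lam d n (Kr d a) j 0).im = 0 := by
  rw [← Complex.conj_eq_iff_im]
  unfold lam
  conv_rhs => rw [← sum_Omega_neg hn _ fun k => by
    rw [exp_dotI_knot_reduceIndex hn, Kr_sub_knot_reduceIndex hn]]
  rw [map_sum]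
  refine Finset.sum_congr rfl fun k _ => ?_
  rw [map_mul, ← Complex.exp_conj, map_mul, Complex.conj_I, Complex.conj_ofReal,
    Complex.conj_ofReal, knot_neg, dotI_neg_right, zero_sub, zero_sub, Kr_neg d a ha (-knot d n k)]
  push_cast
  ring_nf

theorem rho_knot {d : ℕ} {n : Fin d → ℕ} (hn : ∀ i, 1 ≤ n i) (a : (Fin d → ℤ) → ℝ)
    (ha : ∀ l, a (-l) = a l) (j m : Fin d → ℤ) :
    rho d n (Kr d a) j (knot d n m) =
      (Complex.exp (Complex.I * (dotI d j (knot d n m) : ℂ))).re * rho d n (Kr d a) j 0 := by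
  simp only [rho, lam_knot hn a j m, Complex.mul_re, lam_zero_im hn a ha j]
  ring

theorem sum_Omega_exp_eq_zero {d : ℕ} {n : Fin d → ℕ} (hn : ∀ i, 1 ≤ n i) {m : Fin d → ℤ}
    (hm : m ∈ OmegaStar d n) :
    ∑ j ∈ Omega d n, Complex.exp (Complex.I * (dotI d j (knot d n m) : ℂ)) = 0 := by
  obtain ⟨hm0, hm⟩ := Finset.mem_erase.1 hm
  obtain ⟨i, hi⟩ := Function.ne_iff.1 hm0
  simp only [dotI_knot_comm d n _ m]
  have hshift := sum_Omega_add hn (Pi.single i 1)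
    (fun k => Complex.exp (Complex.I * (dotI d m (knot d n k) : ℂ)))
    (exp_dotI_knot_reduceIndex hn m)
  simp only [knot_add, dotI_add_right, Complex.ofReal_add, mul_add, Complex.exp_add] at hshift
  rw [← Finset.sum_mul] at hshift
  by_contra hS
  have h1 := mul_left_cancel₀ hS (hshift.trans (mul_one _).symm)
  obtain ⟨q, hq⟩ := Complex.exp_eq_one_iff.1 h1
  have hni : (n i : ℝ) ≠ 0 := by
    have := hn i
    positivity
  have hdot : dotI d m (knot d n (Pi.single i 1)) = m i * π / n i := by
    rw [dotI, Finset.sum_eq_single i]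
    · simp [knot]
      ring
    · intro b _ hb
      simp [knot, hb]
    · simp
  rw [hdot] at hq
  have hq' : (m i * π / n i : ℝ) = q * (2 * π) := by
    have h : Complex.I * ((m i * π / n i : ℝ) : ℂ) = Complex.I * ((q * (2 * π) : ℝ) : ℂ) := by
      rw [hq]
      push_cast
      ring
    exact_mod_cast mul_left_cancel₀ Complex.I_ne_zero h
  have hmq : (m i : ℝ) = q * (2 * n i) := by
    field_simp at hq'
    linarith
  have hmq' : m i = q * (2 * n i) := by exact_mod_cast hmq
  obtain ⟨h0, h2⟩ := mem_Omega.1 hm i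
  exact hi ((Int.emod_eq_of_lt h0 h2).symm.trans (by rw [hmq']; simp))

theorem fundSk_knot {d : ℕ} {n : Fin d → ℕ} (hn : ∀ i, 1 ≤ n i) (a : (Fin d → ℤ) → ℝ)
    (ha : ∀ l, a (-l) = a l) (hrho : ∀ j ∈ OmegaStar d n, rho d n (Kr d a) j 0 ≠ 0)
    (m : Fin d → ℤ) :
    fundSk d n (Kr d a) (knot d n m) = (1 / Nn d n) *
      (∑ j ∈ Omega d n, Complex.exp (Complex.I * (dotI d j (knot d n m) : ℂ))).re := by
  have h0 : (0 : Fin d → ℤ) ∈ Omega d n :=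
    mem_Omega.2 fun i => ⟨le_rfl, by have := hn i; simp only [Pi.zero_apply]; omega⟩
  have hsum : ∑ j ∈ OmegaStar d n, rho d n (Kr d a) j (knot d n m) / rho d n (Kr d a) j 0 =
      ∑ j ∈ OmegaStar d n, (Complex.exp (Complex.I * (dotI d j (knot d n m) : ℂ))).re :=
    Finset.sum_congr rfl fun j hj => by
      rw [rho_knot hn a ha, mul_div_cancel_right₀ _ (hrho j hj)]
  rw [fundSk, hsum, Complex.re_sum, ← Finset.add_sum_erase _ _ h0, OmegaStar]
  simp [dotI_knot_comm d n 0 m, knot_zero, dotI_zero_right]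
  ring

theorem card_Omega (d : ℕ) (n : Fin d → ℕ) : ((Omega d n).card : ℝ) = Nn d n := by
  rw [Omega, Fintype.card_piFinset, Nn, Nat.cast_prod]
  refine Finset.prod_congr rfl fun i _ => ?_
  have h : (Finset.Icc (0 : ℤ) (2 * (n i : ℤ) - 1)).card = 2 * n i := by
    rw [Int.card_Icc]
    omega
  rw [h]
  push_cast
  ring

/-- Lemma 6: the fundamental sk-spline interpolates the delta data at the knots. -/
theorem statement6 (d : ℕ) (hd : 1 ≤ d) (n : Fin d → ℕ) (hn : ∀ i, 1 ≤ n i)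
    (a : (Fin d → ℤ) → ℝ) (ha : ∀ l, a (-l) = a l)
    (hsum : Summable fun l : Fin d → ℤ => |a l|)
    (hrho : ∀ j ∈ OmegaStar d n, rho d n (Kr d a) j 0 ≠ 0) :
    fundSk d n (Kr d a) (knot d n 0) = 1 ∧
    ∀ k ∈ OmegaStar d n, fundSk d n (Kr d a) (knot d n k) = 0 := by
  have hN : Nn d n ≠ 0 := Finset.prod_ne_zero_iff.2 fun i _ => by
    have := hn i
    positivity
  refine ⟨?_, fun k hk => ?_⟩
  · rw [fundSk_knot hn a ha hrho, knot_zero]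
    simp [dotI_zero_right, card_Omega, hN]
  · rw [fundSk_knot hn a ha hrho, sum_Omega_exp_eq_zero hn hk]
    simp

end
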